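/- Let (Ω, F, p) be a probability space and M : Ω → M_d(ℂ) a random reduced dynamics operator with fixed invariant unit vector ψ_S. Suppose p({ω : M(ω) ∈ ℳ_(E)}) > 0. Then the spectral radius of the expectation matrix E[M_Q] := ∫_Ω M_Q(ω) dp(ω) is strictly less than 1: spr(E[M_Q]) < 1. -/

import Mathlib

open scoped BigOperators
open MeasureTheory Filter ContinuousLinearMap

noncomputable section

abbrev Evec (d : ℕ) := EuclideanSpace ℂ (Fin d)
abbrev Op (d : ℕ) := Evec d →L[ℂ] Evec d

/-- `ketBra u v = |u⟩⟨v|`, the rank-one operator `x ↦ ⟪v, x⟫ • u`. -/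
def ketBra {d : ℕ} (u v : Evec d) : Op d := (innerSL ℂ v).smulRight u

/-- The spectral projection for the eigenvalue `1`, as the limit of Cesàro averages. -/
def cesaroProj {d : ℕ} (A : Op d) : Op d :=
  limUnder atTop (fun N : ℕ => (N : ℂ)⁻¹ • ∑ k ∈ Finset.range N, A ^ k)

/-- The class `ℳ_(E)`. -/
def mcalE {d : ℕ} (ψS : Evec d) (A : Op d) : Prop :=
  (∃ Nrm : Seminorm ℂ (Evec d), (∀ x, Nrm x = 0 → x = 0) ∧ ∀ x, Nrm (A x) ≤ Nrm x) ∧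
  A ψS = ψS ∧
  spectrum ℂ A ∩ {z : ℂ | ‖z‖ = 1} = {1} ∧
  Module.finrank ℂ (Module.End.maxGenEigenspace (A : Evec d →ₗ[ℂ] Evec d) 1) = 1

/-- `ψ(ω) = P₁(ω)* ψ_S`. -/
def psiOf {d : ℕ} (ψS : Evec d) (A : Op d) : Evec d := adjoint (cesaroProj A) ψS

/-- `Q(ω) = 1 - |ψ_S⟩⟨ψ(ω)|`. -/
def Qof {d : ℕ} (ψS : Evec d) (A : Op d) : Op d := 1 - ketBra ψS (psiOf ψS A)

/-- `M_Q(ω) = Q(ω) M(ω) Q(ω)`. -/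
def MQof {d : ℕ} (ψS : Evec d) (A : Op d) : Op d := Qof ψS A * A * Qof ψS A

open scoped Topology ENNReal NNReal

lemma exists_norm_le_of_definite_seminorm {d : ℕ} (N : Seminorm ℂ (Evec d))
    (hN : ∀ x, N x = 0 → x = 0) :
    Continuous N ∧ (∃ K, 0 < K ∧ ∀ x, N x ≤ K * ‖x‖) ∧ ∃ k, 0 < k ∧ ∀ x, k * ‖x‖ ≤ N x := by
  have hc : Continuous N := by
    have h1 : ConvexOn ℝ Set.univ N := N.convexOn
    exact continuousOn_univ.mp (h1.continuousOn isOpen_univ)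
  refine ⟨hc, N.bound_of_continuous_normedSpace hc, ?_⟩
  by_cases hne : (Metric.sphere (0 : Evec d) 1).Nonempty
  · obtain ⟨x₀, hx₀, hmin⟩ := (isCompact_sphere (0 : Evec d) 1).exists_isMinOn hne hc.continuousOn
    have hx₀n : ‖x₀‖ = 1 := by simpa using hx₀
    refine ⟨N x₀, lt_of_le_of_ne (apply_nonneg N _) ?_, fun x => ?_⟩
    · intro h
      have := hN x₀ h.symm
      simp [this] at hx₀n
    · by_cases hx : x = 0
      · simp [hx]
      have hxn : ‖x‖ ≠ 0 := norm_ne_zero_iff.mpr hx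
      have hmem : ((‖x‖ : ℂ)⁻¹ • x) ∈ Metric.sphere (0 : Evec d) 1 := by
        simp [norm_smul, hxn]
      have h2 := isMinOn_iff.mp hmin _ hmem
      rw [map_smul_eq_mul] at h2
      simp only [norm_inv, Complex.norm_real, norm_norm] at h2
      rw [inv_mul_eq_div, le_div_iff₀ (lt_of_le_of_ne (norm_nonneg _) hxn.symm)] at h2
      exact h2
  · refine ⟨1, one_pos, fun x => ?_⟩
    by_cases hx : x = 0
    · simp [hx]
    · exfalso
      apply hne
      have hxn : ‖x‖ ≠ 0 := norm_ne_zero_iff.mpr hx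
      exact ⟨(‖x‖ : ℂ)⁻¹ • x, by simp [norm_smul, hxn]⟩

/-- The seminorm induced on `V` by the quotient of `V` by the line spanned by `u`. -/
def quotientLineSeminorm {V : Type*} [AddCommGroup V] [Module ℂ V] (N : Seminorm ℂ V) (u : V) :
    Seminorm ℂ V :=
  have hbdd : ∀ x, BddBelow (Set.range fun c : ℂ => N (x + c • u)) := fun x =>
    ⟨0, by rintro _ ⟨c, rfl⟩; exact apply_nonneg N _⟩
  Seminorm.ofSMulLE (fun x => ⨅ c : ℂ, N (x + c • u))
    (le_antisymm ((ciInf_le (hbdd 0) 0).trans (by simp))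
      (le_ciInf fun c => apply_nonneg N _))
    (fun x y => by
      refine le_ciInf_add_ciInf fun a b => (ciInf_le (hbdd (x + y)) (a + b)).trans ?_
      refine le_trans (le_of_eq ?_) (map_add_le_add N _ _)
      congr 1
      module)
    (fun r x => by
      rw [Real.mul_iInf_of_nonneg (norm_nonneg _)]
      refine le_ciInf fun c => (ciInf_le (hbdd _) (r * c)).trans (le_of_eq ?_)
      rw [← map_smul_eq_mul]
      congr 1
      module)

section quotientLineSeminorm

variable {V : Type*} [AddCommGroup V] [Module ℂ V] (N : Seminorm ℂ V) (u : V)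

lemma quotientLineSeminorm_apply (x : V) :
    quotientLineSeminorm N u x = ⨅ c : ℂ, N (x + c • u) := rfl

lemma quotientLineSeminorm_le (x : V) (c : ℂ) : quotientLineSeminorm N u x ≤ N (x + c • u) :=
  ciInf_le (f := fun c : ℂ => N (x + c • u))
    ⟨0, by rintro _ ⟨c, rfl⟩; exact apply_nonneg N _⟩ c

lemma quotientLineSeminorm_smul_self (c : ℂ) : quotientLineSeminorm N u (c • u) = 0 :=
  le_antisymm ((quotientLineSeminorm_le N u _ (-c)).trans (by simp)) (apply_nonneg _ _)

lemma quotientLineSeminorm_add_smul (x : V) (c : ℂ) :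
    quotientLineSeminorm N u (x + c • u) = quotientLineSeminorm N u x := by
  refine le_antisymm ?_ ?_
  · simpa [quotientLineSeminorm_smul_self] using
      map_add_le_add (quotientLineSeminorm N u) x (c • u)
  · have := map_add_le_add (quotientLineSeminorm N u) (x + c • u) ((-c) • u)
    rw [quotientLineSeminorm_smul_self] at this
    simpa using this

lemma quotientLineSeminorm_map_le (T : V →ₗ[ℂ] V) (hT : T u = u) (h : ∀ x, N (T x) ≤ N x)
    (x : V) : quotientLineSeminorm N u (T x) ≤ quotientLineSeminorm N u x := by
  refine le_ciInf fun c => (quotientLineSeminorm_le N u (T x) c).trans ?_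
  have := h (x + c • u)
  rwa [map_add, map_smul, hT] at this

end quotientLineSeminorm

lemma mem_span_of_quotientLineSeminorm_eq_zero {d : ℕ} {N : Seminorm ℂ (Evec d)}
    {k : ℝ} (hk : 0 < k) (hN : ∀ x, k * ‖x‖ ≤ N x) (u x : Evec d)
    (hx : quotientLineSeminorm N u x = 0) : x ∈ Submodule.span ℂ {u} := by
  have hcl : IsClosed ((Submodule.span ℂ {u} : Submodule ℂ (Evec d)) : Set (Evec d)) :=
    Submodule.closed_of_finiteDimensional _
  change x ∈ ((Submodule.span ℂ {u} : Submodule ℂ (Evec d)) : Set (Evec d))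
  rw [hcl.mem_iff_infDist_zero ⟨0, Submodule.zero_mem _⟩]
  refine le_antisymm ?_ Metric.infDist_nonneg
  have : k * Metric.infDist x (Submodule.span ℂ {u} : Submodule ℂ (Evec d)) ≤ 0 := by
    rw [← hx]
    refine le_ciInf fun c => le_trans ?_ (hN _)
    gcongr
    have hmem : (-c) • u ∈ ((Submodule.span ℂ {u} : Submodule ℂ (Evec d)) : Set (Evec d)) :=
      Submodule.smul_mem _ _ (Submodule.mem_span_singleton_self u)
    refine (Metric.infDist_le_dist_of_mem hmem).trans (le_of_eq ?_)
    rw [dist_eq_norm]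
    congr 1
    module
  nlinarith [Metric.infDist_nonneg (x := x)
    (s := ((Submodule.span ℂ {u} : Submodule ℂ (Evec d)) : Set (Evec d)))]

lemma exists_norm_le_of_contraction {d : ℕ} (N : Seminorm ℂ (Evec d))
    (hN : ∀ x, N x = 0 → x = 0) :
    ∃ C : ℝ, ∀ A : Op d, (∀ x, N (A x) ≤ N x) → ‖A‖ ≤ C := by
  obtain ⟨-, ⟨K, hK, hNK⟩, k, hk, hkN⟩ := exists_norm_le_of_definite_seminorm N hN
  refine ⟨K / k, fun A hA => ContinuousLinearMap.opNorm_le_bound _ (by positivity) fun x => ?_⟩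
  have := (hkN (A x)).trans ((hA x).trans (hNK x))
  rw [div_mul_eq_mul_div, le_div_iff₀ hk]
  linarith

lemma seminorm_pow_le {d : ℕ} {N : Seminorm ℂ (Evec d)} {A : Op d}
    (h : ∀ x, N (A x) ≤ N x) (n : ℕ) (x : Evec d) : N ((A ^ n) x) ≤ N x := by
  induction n with
  | zero => simp
  | succ n ih => rw [pow_succ']; exact (h _).trans ih

section Cesaro

variable {B : Type*} [Ring B] [Algebra ℂ B]

lemma mul_cesaro_sub (a : B) (N : ℕ) :
    a * ((N : ℂ)⁻¹ • ∑ k ∈ Finset.range N, a ^ k) - (N : ℂ)⁻¹ • ∑ k ∈ Finset.range N, a ^ k =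
      (N : ℂ)⁻¹ • (a ^ N - 1) := by
  rw [mul_smul_comm, ← smul_sub, ← mul_geom_sum, sub_mul, one_mul]

lemma cesaro_mul_sub (a : B) (N : ℕ) :
    ((N : ℂ)⁻¹ • ∑ k ∈ Finset.range N, a ^ k) * a - (N : ℂ)⁻¹ • ∑ k ∈ Finset.range N, a ^ k =
      (N : ℂ)⁻¹ • (a ^ N - 1) := by
  rw [smul_mul_assoc, ← smul_sub, ← geom_sum_mul, mul_sub, mul_one]

lemma cesaro_mul_of_mul_eq {a t : B} (h : a * t = t) {N : ℕ} (hN : 1 ≤ N) :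
    ((N : ℂ)⁻¹ • ∑ k ∈ Finset.range N, a ^ k) * t = t := by
  have hp : ∀ k, a ^ k * t = t := by
    intro k
    induction k with
    | zero => simp
    | succ k ih => rw [pow_succ, mul_assoc, h, ih]
  have hN0 : (N : ℂ) ≠ 0 := by exact_mod_cast (by omega : N ≠ 0)
  simp only [smul_mul_assoc, Finset.sum_mul, hp]
  rw [Finset.sum_const, Finset.card_range, ← Nat.cast_smul_eq_nsmul ℂ, smul_smul,
    inv_mul_cancel₀ hN0, one_smul]

lemma mul_cesaro_of_mul_eq {a t : B} (h : t * a = t) {N : ℕ} (hN : 1 ≤ N) :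
    t * ((N : ℂ)⁻¹ • ∑ k ∈ Finset.range N, a ^ k) = t := by
  have hp : ∀ k, t * a ^ k = t := by
    intro k
    induction k with
    | zero => simp
    | succ k ih => rw [pow_succ', ← mul_assoc, h, ih]
  have hN0 : (N : ℂ) ≠ 0 := by exact_mod_cast (by omega : N ≠ 0)
  simp only [mul_smul_comm, Finset.mul_sum, hp]
  rw [Finset.sum_const, Finset.card_range, ← Nat.cast_smul_eq_nsmul ℂ, smul_smul,
    inv_mul_cancel₀ hN0, one_smul]

end Cesaro

/-- The mean ergodic theorem for power-bounded operators in finite dimension. -/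
lemma tendsto_cesaroProj {d : ℕ} {A : Op d} {C : ℝ} (hC : ∀ n, ‖A ^ n‖ ≤ C) :
    Tendsto (fun N : ℕ => (N : ℂ)⁻¹ • ∑ k ∈ Finset.range N, A ^ k) atTop (𝓝 (cesaroProj A)) ∧
    A * cesaroProj A = cesaroProj A ∧ cesaroProj A * A = cesaroProj A := by
  set c : ℕ → Op d := fun N => (N : ℂ)⁻¹ • ∑ k ∈ Finset.range N, A ^ k with hc
  have hC0 : 0 ≤ C := (norm_nonneg _).trans (hC 0)
  have : ProperSpace (Op d) := FiniteDimensional.proper ℂ _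
  have hb : ∀ N, c N ∈ Metric.closedBall (0 : Op d) C := by
    intro N
    rw [mem_closedBall_zero_iff, hc]
    simp only [norm_smul, norm_inv, RCLike.norm_natCast]
    have h1 : ‖∑ k ∈ Finset.range N, A ^ k‖ ≤ N * C := by
      simpa using norm_sum_le_of_le (Finset.range N) (fun k _ => hC k)
    rcases Nat.eq_zero_or_pos N with rfl | hN
    · simpa using hC0
    · have : (0 : ℝ) < N := by exact_mod_cast hN
      rw [inv_mul_le_iff₀ this]
      exact h1
  have hdiff : Tendsto (fun N : ℕ => (N : ℂ)⁻¹ • (A ^ N - 1)) atTop (𝓝 0) := by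
    refine squeeze_zero_norm (a := fun N : ℕ => (N : ℝ)⁻¹ * (C + C)) (fun N => ?_) ?_
    · rw [norm_smul, norm_inv, RCLike.norm_natCast]
      gcongr
      refine (norm_sub_le _ _).trans (add_le_add (hC N) ?_)
      simpa using hC 0
    · simpa using (tendsto_inv_atTop_nhds_zero_nat (𝕜 := ℝ)).mul_const (C + C)
  have hl : ∀ N, A * c N - c N = (N : ℂ)⁻¹ • (A ^ N - 1) := fun N => mul_cesaro_sub A N
  have hr : ∀ N, c N * A - c N = (N : ℂ)⁻¹ • (A ^ N - 1) := fun N => cesaro_mul_sub A N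
  have hcl : ∀ T, MapClusterPt T atTop c → A * T = T ∧ T * A = T := by
    intro T hT
    obtain ⟨U, hU, hUT⟩ := mapClusterPt_iff_ultrafilter.mp hT
    constructor
    · have h1 := (hUT.const_mul A).sub hUT
      simp only [hl] at h1
      exact sub_eq_zero.mp (tendsto_nhds_unique h1 (hdiff.mono_left hU))
    · have h1 := (hUT.mul_const A).sub hUT
      simp only [hr] at h1
      exact sub_eq_zero.mp (tendsto_nhds_unique h1 (hdiff.mono_left hU))
  have huniq : ∀ S T, MapClusterPt S atTop c → MapClusterPt T atTop c → S = T := by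
    intro S T hS hT
    obtain ⟨U, hU, hUS⟩ := mapClusterPt_iff_ultrafilter.mp hS
    obtain ⟨W, hW, hWT⟩ := mapClusterPt_iff_ultrafilter.mp hT
    have h1 : S * T = T := by
      refine tendsto_nhds_unique (hUS.mul_const T) (tendsto_const_nhds.congr' ?_)
      filter_upwards [hU (eventually_ge_atTop 1)] with N hN
      exact (cesaro_mul_of_mul_eq (hcl T hT).1 hN).symm
    have h2 : S * T = S := by
      refine tendsto_nhds_unique (hWT.const_mul S) (tendsto_const_nhds.congr' ?_)
      filter_upwards [hW (eventually_ge_atTop 1)] with N hN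
      exact (mul_cesaro_of_mul_eq (hcl S hS).2 hN).symm
    exact h2.symm.trans h1
  have hcomp : IsCompact (Metric.closedBall (0 : Op d) C) := isCompact_closedBall _ _
  obtain ⟨P, -, hP⟩ := hcomp.exists_mapClusterPt (f := atTop) (u := c)
    (tendsto_principal.mpr (Eventually.of_forall hb))
  have htend : Tendsto c atTop (𝓝 P) :=
    hcomp.tendsto_nhds_of_unique_mapClusterPt (Eventually.of_forall hb)
      fun T _ hT => huniq T P hT hP
  have hlim : cesaroProj A = P := htend.limUnder_eq
  rw [hlim]
  exact ⟨htend, hcl P hP⟩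

lemma cesaroProj_apply_of_fixed {d : ℕ} {A : Op d} {C : ℝ} (hC : ∀ n, ‖A ^ n‖ ≤ C)
    {x : Evec d} (hx : A x = x) : cesaroProj A x = x := by
  have h := ((ContinuousLinearMap.apply ℂ (Evec d) x).continuous.tendsto _).comp
    (tendsto_cesaroProj hC).1
  refine tendsto_nhds_unique h (tendsto_const_nhds.congr' ?_)
  filter_upwards [eventually_ge_atTop 1] with N hN
  have hp : ∀ k, (A ^ k) x = x := by
    intro k
    induction k with
    | zero => simp
    | succ k ih => rw [pow_succ', mul_apply_eq_comp, ih, hx]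
  have hN0 : (N : ℂ) ≠ 0 := by exact_mod_cast (by omega : N ≠ 0)
  simp [hp, ← Nat.cast_smul_eq_nsmul ℂ, smul_smul,
    inv_mul_cancel₀ hN0]

lemma exists_eigenvector_of_mem_spectrum {d : ℕ} {A : Op d} {z : ℂ} (hz : z ∈ spectrum ℂ A) :
    ∃ v, v ≠ 0 ∧ A v = z • v := by
  rw [ContinuousLinearMap.spectrum_eq] at hz
  obtain ⟨v, hv⟩ := (Module.End.HasEigenvalue.of_mem_spectrum hz).exists_hasEigenvector
  exact ⟨v, hv.2, hv.apply_eq_smul⟩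

lemma mem_spectrum_of_apply_eq_smul {d : ℕ} {A : Op d} {z : ℂ} {v : Evec d} (hv : v ≠ 0)
    (h : A v = z • v) : z ∈ spectrum ℂ A := by
  rw [ContinuousLinearMap.spectrum_eq]
  exact (Module.End.hasEigenvalue_of_hasEigenvector
    (Module.End.hasEigenvector_iff.mpr ⟨Module.End.mem_eigenspace_iff.mpr h, hv⟩)).mem_spectrum

lemma tendsto_pow_of_spectralRadius_lt_one {B : Type*} [NormedRing B] [NormedAlgebra ℂ B]
    [CompleteSpace B] (a : B) (ha : spectralRadius ℂ a < 1) :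
    Tendsto (fun n : ℕ => a ^ n) atTop (𝓝 0) := by
  obtain ⟨r, hr, hr1⟩ := exists_between ha
  lift r to ℝ≥0 using (hr1.trans ENNReal.one_lt_top).ne
  have hr1' : (r : ℝ) < 1 := by exact_mod_cast hr1
  refine squeeze_zero_norm' (a := fun n : ℕ => (r : ℝ) ^ n) ?_
    (tendsto_pow_atTop_nhds_zero_of_lt_one r.coe_nonneg hr1')
  filter_upwards [(spectrum.pow_nnnorm_pow_one_div_tendsto_nhds_spectralRadius a).eventually
    (gt_mem_nhds hr), eventually_gt_atTop 0] with n hn hn0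
  have hn0' : (0 : ℝ) < n := by exact_mod_cast hn0
  have h1 : (‖a ^ n‖₊ : ℝ≥0∞) ≤ (r : ℝ≥0∞) ^ n := by
    rw [← ENNReal.rpow_natCast, ← ENNReal.rpow_inv_le_iff hn0']
    simpa using hn.le
  exact_mod_cast h1

lemma tendsto_pow_sub_cesaroProj {d : ℕ} (hd : 1 ≤ d) {ψS : Evec d} {A : Op d}
    (hA : mcalE ψS A) : Tendsto (fun n : ℕ => A ^ n - cesaroProj A) atTop (𝓝 0) := by
  obtain ⟨⟨N, hN, hcon⟩, -, hspec, -⟩ := hA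
  obtain ⟨C, hC⟩ := exists_norm_le_of_contraction N hN
  have hpow : ∀ n, ‖A ^ n‖ ≤ C := fun n => hC _ (seminorm_pow_le hcon n)
  obtain ⟨-, hAP, hPA⟩ := tendsto_cesaroProj hpow
  set P := cesaroProj A with hP
  have hPP : P * P = P := by
    ext1 x
    exact cesaroProj_apply_of_fixed hpow (DFunLike.congr_fun hAP x)
  have hnt : Nontrivial (Evec d) := by
    have : Nonempty (Fin d) := ⟨⟨0, hd⟩⟩
    infer_instance
  have hpw : ∀ n, (A - P) ^ (n + 1) = A ^ (n + 1) - P := by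
    intro n
    induction n with
    | zero => simp
    | succ n ih =>
      have hAnP : ∀ n, A ^ n * P = P := by
        intro n
        induction n with
        | zero => simp
        | succ n ih => rw [pow_succ, mul_assoc, hAP, ih]
      rw [pow_succ, ih, sub_mul, mul_sub, mul_sub, hPA, hPP, hAnP, ← pow_succ, sub_self, sub_zero]
  have hspr : spectralRadius ℂ (A - P) < 1 := by
    refine spectrum.spectralRadius_lt_of_forall_lt (A - P) (r := 1) fun z hz => ?_
    obtain ⟨v, hv, hzv⟩ := exists_eigenvector_of_mem_spectrum hz
    by_contra! hz1
    have hz1 : 1 ≤ ‖z‖ := by exact_mod_cast hz1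
    have hz0 : z ≠ 0 := by rintro rfl; simp at hz1; linarith
    have hPv : P v = 0 := by
      have h1 : P ((A - P) v) = 0 := by
        rw [← mul_apply_eq_comp, mul_sub, hPA, hPP, sub_self]; rfl
      rw [hzv, map_smul] at h1
      exact (smul_eq_zero.mp h1).resolve_left hz0
    have hAv : A v = z • v := by simpa [hPv] using hzv
    have hle := hcon v
    rw [hAv, map_smul_eq_mul] at hle
    have hNv : 0 < N v := lt_of_le_of_ne (apply_nonneg N v) fun h => hv (hN v h.symm)
    have hz1' : ‖z‖ = 1 := le_antisymm (by nlinarith) hz1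
    have hmem : z ∈ spectrum ℂ A ∩ {z : ℂ | ‖z‖ = 1} :=
      ⟨mem_spectrum_of_apply_eq_smul hv hAv, hz1'⟩
    rw [hspec] at hmem
    rw [Set.mem_singleton_iff.mp hmem, one_smul] at hAv
    exact hv ((cesaroProj_apply_of_fixed hpow hAv).symm.trans hPv)
  have ht := tendsto_pow_of_spectralRadius_lt_one _ hspr
  rw [← tendsto_add_atTop_iff_nat 1] at ht ⊢
  simpa only [hpw] using ht

lemma mem_span_of_fixed {d : ℕ} {ψS : Evec d} (hψ : ψS ≠ 0) {A : Op d} (hA : mcalE ψS A)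
    {x : Evec d} (hx : A x = x) : ∃ c : ℂ, x = c • ψS := by
  obtain ⟨-, hfix, -, hrank⟩ := hA
  have hmem : ∀ y, A y = y →
      y ∈ Module.End.maxGenEigenspace (A : Evec d →ₗ[ℂ] Evec d) 1 := fun y hy =>
    (Module.End.mem_maxGenEigenspace _ _ _).mpr ⟨1, by simp [hy]⟩
  obtain ⟨c, hc⟩ := (finrank_eq_one_iff_of_nonzero' (⟨ψS, hmem ψS hfix⟩ :
    Module.End.maxGenEigenspace (A : Evec d →ₗ[ℂ] Evec d) 1)
    (by simpa [Subtype.ext_iff] using hψ)).mp hrank ⟨x, hmem x hx⟩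
  exact ⟨c, (congrArg Subtype.val hc).symm⟩

/-- Iterates of a member of `ℳ_(E)` contract any vector modulo the invariant line. -/
lemma exists_seminorm_pow_lt {d : ℕ} (hd : 1 ≤ d) {ψS : Evec d} (hψ : ψS ≠ 0) {A : Op d}
    (hA : mcalE ψS A) {s : Seminorm ℂ (Evec d)} (hs : Continuous s)
    (hs0 : ∀ c : ℂ, s (c • ψS) = 0) {v : Evec d} (hv : 0 < s v) :
    ∃ n : ℕ, s ((A ^ n) v) < s v := by
  have hAP : A * cesaroProj A = cesaroProj A := by
    obtain ⟨N, hN, hcon⟩ := hA.1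
    obtain ⟨C, hC⟩ := exists_norm_le_of_contraction N hN
    exact (tendsto_cesaroProj fun n => hC _ (seminorm_pow_le hcon n)).2.1
  obtain ⟨c, hc⟩ := mem_span_of_fixed hψ hA (x := cesaroProj A v)
    (DFunLike.congr_fun hAP v)
  have h1 : Tendsto (fun n : ℕ => s ((A ^ n - cesaroProj A) v)) atTop (𝓝 (s ((0 : Op d) v))) :=
    ((hs.comp (ContinuousLinearMap.apply ℂ (Evec d) v).continuous).tendsto _).comp
      (tendsto_pow_sub_cesaroProj hd hA)
  rw [zero_apply, map_zero] at h1
  obtain ⟨n, hn⟩ := (h1.eventually (gt_mem_nhds hv)).exists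
  refine ⟨n, lt_of_le_of_lt ?_ hn⟩
  have h2 := map_add_le_add s ((A ^ n - cesaroProj A) v) (cesaroProj A v)
  rw [hc, hs0, ← hc] at h2
  simpa using h2

lemma convex_isClosed_setOf_seminorm_contraction {d : ℕ} {s : Seminorm ℂ (Evec d)}
    (hs : Continuous s) :
    Convex ℝ {T : Op d | ∀ x, s (T x) ≤ s x} ∧ IsClosed {T : Op d | ∀ x, s (T x) ≤ s x} := by
  constructor
  · intro T hT S hS a b ha hb hab x
    have h1 := map_add_le_add s ((a : ℂ) • T x) ((b : ℂ) • S x)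
    rw [map_smul_eq_mul, map_smul_eq_mul, Complex.norm_real, Complex.norm_real,
      Real.norm_of_nonneg ha, Real.norm_of_nonneg hb] at h1
    have h2 := mul_le_mul_of_nonneg_left (hT x) ha
    have h3 := mul_le_mul_of_nonneg_left (hS x) hb
    have h4 : a * s x + b * s x = s x := by rw [← add_mul, hab, one_mul]
    calc s ((a • T + b • S) x) = s ((a : ℂ) • T x + (b : ℂ) • S x) := by simp
      _ ≤ s x := by linarith
  · rw [Set.ofPred_forall]
    exact isClosed_iInter fun x => isClosed_le
      (hs.comp (ContinuousLinearMap.apply ℂ (Evec d) x).continuous) continuous_const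

lemma seminorm_integral_apply_le {d : ℕ} {s : Seminorm ℂ (Evec d)} (hs : Continuous s)
    {Ω : Type*} [MeasurableSpace Ω] (μ : Measure Ω) [IsFiniteMeasure μ] {f : Ω → Op d}
    (hf : Integrable f μ) (hfs : ∀ ω x, s (f ω x) ≤ s x) (x : Evec d) :
    s ((∫ ω, f ω ∂μ) x) ≤ μ.real Set.univ * s x := by
  rcases eq_or_ne μ 0 with rfl | hμ
  · simp
  have : NeZero μ := ⟨hμ⟩
  obtain ⟨hcv, hcl⟩ := convex_isClosed_setOf_seminorm_contraction hs
  have h := hcv.average_mem hcl (Eventually.of_forall hfs) hf x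
  rw [← measure_smul_average μ f]
  have h2 : (μ.real Set.univ • ⨍ ω, f ω ∂μ) x
      = ((μ.real Set.univ : ℝ) : ℂ) • (⨍ ω, f ω ∂μ) x := by
    rw [Complex.coe_smul]; rfl
  rw [h2, map_smul_eq_mul, Complex.norm_real, Real.norm_of_nonneg measureReal_nonneg]
  gcongr

lemma seminorm_pow_apply_le_of_eq_smul_add {d : ℕ} {s : Seminorm ℂ (Evec d)} {E B D : Op d} {q : ℝ}
    (hq : 0 ≤ q) (hq1 : q ≤ 1) (hE : E = (q : ℂ) • B + D) (hEs : ∀ x, s (E x) ≤ s x)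
    (hDs : ∀ x, s (D x) ≤ (1 - q) * s x) (v : Evec d) (n : ℕ) :
    ∀ W : Op d, (∀ x, s (W x) ≤ s x) → (∀ x, s (B x) ≤ s x) →
      s (W ((E ^ n) v)) ≤ q ^ n * s (W ((B ^ n) v)) + (1 - q ^ n) * s v := by
  induction n with
  | zero => intro W _ _; simp
  | succ n ih =>
    intro W hW hB
    have h1 : W ((E ^ (n + 1)) v) = (q : ℂ) • (W * B) ((E ^ n) v) + W (D ((E ^ n) v)) := by
      rw [pow_succ', mul_apply_eq_comp]
      nth_rewrite 1 [hE]
      simp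
    have h2 := map_add_le_add s ((q : ℂ) • (W * B) ((E ^ n) v)) (W (D ((E ^ n) v)))
    rw [map_smul_eq_mul, Complex.norm_real, Real.norm_of_nonneg hq] at h2
    have h3 := mul_le_mul_of_nonneg_left
      (ih (W * B) (fun x => (hW _).trans (hB x)) hB) hq
    have h4 : s (W (D ((E ^ n) v))) ≤ (1 - q) * s v := by
      refine (hW _).trans ((hDs _).trans ?_)
      exact mul_le_mul_of_nonneg_left (seminorm_pow_le hEs n v) (by linarith)
    have h5 : (W * B) ((B ^ n) v) = W ((B ^ (n + 1)) v) := by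
      rw [pow_succ']; rfl
    rw [h5] at h3
    rw [h1]
    calc _ ≤ _ := h2
      _ ≤ q * (q ^ n * s (W ((B ^ (n + 1)) v)) + (1 - q ^ n) * s v) + (1 - q) * s v := by
        linarith
      _ = _ := by ring

lemma MQof_apply_invariant {d : ℕ} {ψS : Evec d} (hψS : ‖ψS‖ = 1) {A : Op d} {C : ℝ}
    (hC : ∀ n, ‖A ^ n‖ ≤ C) (hfix : A ψS = ψS) : MQof ψS A ψS = 0 := by
  have hQ : Qof ψS A ψS = 0 := by
    simp [Qof, ketBra, psiOf, ContinuousLinearMap.adjoint_inner_left,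
      cesaroProj_apply_of_fixed hC hfix, inner_self_eq_norm_sq_to_K, hψS]
  simp [MQof, hQ]

lemma exists_MQof_apply_eq {d : ℕ} {ψS : Evec d} {A : Op d} (hfix : A ψS = ψS) (x : Evec d) :
    ∃ c : ℂ, c • ψS = A x - MQof ψS A x := by
  refine ⟨inner ℂ (psiOf ψS A) x + inner ℂ (psiOf ψS A)
    (A x - (inner ℂ (psiOf ψS A) x : ℂ) • ψS), ?_⟩
  simp only [MQof, Qof, ketBra, mul_apply_eq_comp, sub_apply,
    one_apply_eq_self, ContinuousLinearMap.smulRight_apply, innerSL_apply_apply,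
    map_sub, map_smul, hfix, inner_sub_right,
    inner_smul_right]
  module

/-- for an RRDO with `p(M(ω) ∈ ℳ_(E)) > 0`, the spectral radius of
`E[M_Q] = ∫ M_Q(ω) dp(ω)` is strictly less than `1`. -/
theorem stmt9 {d : ℕ} (hd : 1 ≤ d) {Ω : Type*} [MeasurableSpace Ω]
    (p : Measure Ω) [IsProbabilityMeasure p]
    (M : Ω → Op d) (hMmeas : Measurable M)
    (Nrm : Seminorm ℂ (Evec d)) (hNrm : ∀ x, Nrm x = 0 → x = 0)
    (hcontr : ∀ (ω : Ω) (x : Evec d), Nrm (M ω x) ≤ Nrm x)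
    (ψS : Evec d) (hψS : ‖ψS‖ = 1) (hfix : ∀ ω, M ω ψS = ψS)
    (hpos : 0 < p {ω | mcalE ψS (M ω)}) :
    spectralRadius ℂ (∫ ω, MQof ψS (M ω) ∂p) < 1 := by
  by_cases hint : Integrable (fun ω => MQof ψS (M ω)) p
  swap
  · rw [integral_undef hint, spectrum.spectralRadius_zero]
    exact one_pos
  have hψ : ψS ≠ 0 := by rintro rfl; simp at hψS
  have hnt : Nontrivial (Evec d) := ⟨ψS, 0, hψ⟩
  have hproper : ProperSpace (Op d) := FiniteDimensional.proper ℂ _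
  obtain ⟨C, hC⟩ := exists_norm_le_of_contraction Nrm hNrm
  obtain ⟨hNc, -, k, hk, hkN⟩ := exists_norm_le_of_definite_seminorm Nrm hNrm
  have hMint : Integrable M p :=
    Integrable.of_bound hMmeas.aestronglyMeasurable C
      (Eventually.of_forall fun ω => hC _ (hcontr ω))
  set s := quotientLineSeminorm Nrm ψS with hs_def
  have hs : Continuous s := Seminorm.continuous_of_le hNc fun x => by
    simpa using quotientLineSeminorm_le Nrm ψS x 0
  have hMs : ∀ ω x, s (M ω x) ≤ s x := fun ω x =>
    quotientLineSeminorm_map_le Nrm ψS (M ω : Evec d →ₗ[ℂ] Evec d) (hfix ω) (hcontr ω) x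
  set E := ∫ ω, M ω ∂p with hE
  have hEs : ∀ x, s (E x) ≤ s x := fun x => by
    simpa using seminorm_integral_apply_le hs p hMint hMs x
  have hEψ : E ψS = ψS := by
    rw [hE, ContinuousLinearMap.integral_apply hMint]
    simp [hfix]
  refine spectrum.spectralRadius_lt_of_forall_lt _ (r := 1) fun z hz => ?_
  obtain ⟨v, hv, hzv⟩ := exists_eigenvector_of_mem_spectrum hz
  by_contra! hz1
  have hz1 : 1 ≤ ‖z‖ := by exact_mod_cast hz1
  have hXψ : (∫ ω, MQof ψS (M ω) ∂p) ψS = 0 := by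
    rw [ContinuousLinearMap.integral_apply hint]
    simp [MQof_apply_invariant hψS (fun n => hC _ (seminorm_pow_le (hcontr _) n)) (hfix _)]
  have hvspan : v ∉ Submodule.span ℂ {ψS} := by
    intro hmem
    obtain ⟨c, rfl⟩ := Submodule.mem_span_singleton.mp hmem
    rw [map_smul, hXψ, smul_zero] at hzv
    rcases smul_eq_zero.mp hzv.symm with h | h
    · simp [h] at hz1
      linarith
    · exact hv h
  have hsv : 0 < s v := lt_of_le_of_ne (apply_nonneg s v) fun h =>
    hvspan (mem_span_of_quotientLineSeminorm_eq_zero hk hkN ψS v h.symm)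
  have hEv : ∃ c : ℂ, E v = z • v + c • ψS := by
    have hmem : (∫ ω, (M ω v - MQof ψS (M ω) v) ∂p) ∈
        ((Submodule.span ℂ {ψS} : Submodule ℂ (Evec d)) : Set (Evec d)) := by
      refine Convex.integral_mem ?_ (Submodule.closed_of_finiteDimensional _)
        (Eventually.of_forall fun ω => ?_)
        ((hMint.apply_continuousLinearMap v).sub (hint.apply_continuousLinearMap v))
      · exact ((Submodule.span ℂ {ψS}).restrictScalars ℝ).convex
      · exact Submodule.mem_span_singleton.mpr (exists_MQof_apply_eq (hfix ω) v)
    rw [integral_sub (hMint.apply_continuousLinearMap v) (hint.apply_continuousLinearMap v),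
      ← ContinuousLinearMap.integral_apply hMint, ← ContinuousLinearMap.integral_apply hint,
      hzv] at hmem
    obtain ⟨c, hc⟩ := Submodule.mem_span_singleton.mp hmem
    exact ⟨c, by rw [hc]; simp [hE]⟩
  obtain ⟨c, hc⟩ := hEv
  have hEn : ∀ n : ℕ, ∃ a : ℂ, (E ^ n) v = z ^ n • v + a • ψS := by
    intro n
    induction n with
    | zero => exact ⟨0, by simp⟩
    | succ n ih =>
      obtain ⟨a, ha⟩ := ih
      refine ⟨z ^ n * c + a, ?_⟩
      rw [pow_succ', mul_apply_eq_comp, ha, map_add, map_smul, map_smul, hc, hEψ]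
      module
  have hlow : ∀ n : ℕ, s v ≤ s ((E ^ n) v) := by
    intro n
    obtain ⟨a, ha⟩ := hEn n
    rw [ha, hs_def, quotientLineSeminorm_add_smul, map_smul_eq_mul, norm_pow]
    exact le_mul_of_one_le_left (apply_nonneg _ _) (one_le_pow₀ hz1)
  have hmap : p.map M {A | mcalE ψS A} ≠ 0 :=
    (hpos.trans_le (Measure.le_map_apply hMmeas.aemeasurable _)).ne'
  obtain ⟨A, hA, hAsupp⟩ := exists_mem_forall_mem_nhdsWithin_pos_measure hmap
  obtain ⟨n, hn⟩ := exists_seminorm_pow_lt hd hψ hA hs (quotientLineSeminorm_smul_self Nrm ψS) hsv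
  have hcont : Continuous fun T : Op d => s ((T ^ n) v) :=
    hs.comp ((ContinuousLinearMap.apply ℂ (Evec d) v).continuous.comp (continuous_pow n))
  obtain ⟨δ, hδ, hball⟩ := Metric.nhds_basis_closedBall.mem_iff.mp
    (hcont.continuousAt.eventually (gt_mem_nhds hn))
  set S := M ⁻¹' Metric.closedBall A δ with hS
  have hSm : MeasurableSet S := hMmeas Metric.isClosed_closedBall.measurableSet
  have hSpos : p S ≠ 0 := by
    have := hAsupp _ (mem_nhdsWithin_of_mem_nhds (Metric.closedBall_mem_nhds A hδ))
    rw [Measure.map_apply hMmeas Metric.isClosed_closedBall.measurableSet] at this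
    exact this.ne'
  set B := ⨍ ω in S, M ω ∂p with hB
  have hBball : B ∈ Metric.closedBall A δ :=
    (convex_closedBall A δ).set_average_mem Metric.isClosed_closedBall hSpos (measure_ne_top _ _)
      ((ae_restrict_iff' hSm).mpr (Eventually.of_forall fun ω h => h)) hMint.integrableOn
  obtain ⟨hcv, hcl⟩ := convex_isClosed_setOf_seminorm_contraction hs
  have hBs : ∀ x, s (B x) ≤ s x :=
    hcv.set_average_mem hcl hSpos (measure_ne_top _ _) (Eventually.of_forall hMs)
      hMint.integrableOn
  have hDs : ∀ x, s ((∫ ω in Sᶜ, M ω ∂p) x) ≤ (1 - p.real S) * s x := fun x => by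
    have := seminorm_integral_apply_le hs (p.restrict Sᶜ) hMint.integrableOn hMs x
    rwa [measureReal_restrict_apply_univ, probReal_compl_eq_one_sub hSm] at this
  have hED : E = (p.real S : ℂ) • B + ∫ ω in Sᶜ, M ω ∂p := by
    rw [hE, ← integral_add_compl hSm hMint, hB, ← measure_smul_setAverage M (measure_ne_top p S)]
    congr 1
  have hup := seminorm_pow_apply_le_of_eq_smul_add measureReal_nonneg measureReal_le_one hED hEs
    hDs v n 1 (fun x => le_rfl) hBs
  have hq : 0 < p.real S ^ n :=
    pow_pos (ENNReal.toReal_pos hSpos (measure_ne_top _ _)) n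
  have hBn : s ((B ^ n) v) < s v := hball hBball
  have hl := hlow n
  simp only [one_apply_eq_self] at hup
  nlinarith
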